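/- Let A be a commutative arithmetical ring. Then A has Krull dimension if and only if every factor ring of A is finite-dimensional and has no idempotent proper essential ideal. -/

import Mathlib

open MulOpposite

/-- Deviation (Gabriel–Rentschler Krull dimension) of a preorder is `≤ α`:
in every strictly descending chain, all but finitely many of the
intervals (corresponding to successive factor modules) have deviation `< α`. -/
def DevLE (α : Ordinal.{0}) (P : Type) (inst : Preorder P) : Prop :=
  ∀ f : ℕ → P, (∀ n : ℕ, inst.lt (f (n + 1)) (f n)) →
    ∃ N : ℕ, ∀ n : ℕ, N ≤ n → ∃ β : Ordinal.{0}, ∃ _ : β < α,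
      DevLE β {x : P // inst.le (f (n + 1)) x ∧ inst.le x (f n)}
        (@Subtype.preorder P inst fun x => inst.le (f (n + 1)) x ∧ inst.le x (f n))
termination_by α

/-- A preorder has Krull dimension (deviation) if its deviation exists as an ordinal. -/
def HasKdimO (P : Type) [inst : Preorder P] : Prop := ∃ α : Ordinal.{0}, DevLE α P inst

/-- A module has Gabriel–Rentschler Krull dimension: the deviation of its submodule
lattice exists (intervals of this lattice are the submodule lattices of the
subquotients, so this agrees with the transfinite definition via factor modules). -/
def ModHasKdim (R M : Type) [Ring R] [AddCommGroup M] [Module R M] : Prop :=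
  HasKdimO (Submodule R M)

/-- A complete lattice (of submodules/ideals) is finite-dimensional: it contains no
infinite independent family (direct sum) of nonzero elements. -/
def FinDimL (L : Type) [CompleteLattice L] : Prop :=
  ¬ ∃ f : ℕ → L, (∀ n, f n ≠ ⊥) ∧ ∀ n, f n ⊓ (⨆ m, ⨆ _ : m ≠ n, f m) = ⊥

/-- A commutative ring is arithmetical if its lattice of ideals is distributive. -/
def Arithmetical (A : Type) [CommRing A] : Prop :=
  ∀ I J K : Ideal A, I ⊓ (J ⊔ K) = I ⊓ J ⊔ I ⊓ K

/-- A commutative ring has no idempotent proper essential ideal. -/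
def NoIdemEss (A : Type) [CommRing A] : Prop :=
  ∀ B : Ideal A, B ≠ ⊤ → (∀ C : Ideal A, C ≠ ⊥ → B ⊓ C ≠ ⊥) → B * B ≠ B

/-- The interval from `a` to `b` carries a densely ordered relation, i.e. a nonempty relation
contained in `<` in which every related pair admits a related intermediate element. -/
def DenselySplit {P : Type*} [Preorder P] (a b : P) : Prop :=
  ∃ T : P → P → Prop, (∀ x y, T x y → x < y) ∧ (∀ x y, T x y → ∃ z, T x z ∧ T z y) ∧ T a b

section Deviation

theorem DevLE.of_strictMono (α : Ordinal.{0}) : ∀ (P Q : Type) (iP : Preorder P)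
    (iQ : Preorder Q) (φ : P → Q), Monotone φ → StrictMono φ → DevLE α Q iQ → DevLE α P iP := by
  induction α using WellFoundedLT.induction with
  | _ α ih =>
    intro P Q iP iQ φ hm hs hQ
    rw [DevLE] at hQ ⊢
    intro f hf
    obtain ⟨N, hN⟩ := hQ (fun n => φ (f n)) (fun n => hs (hf n))
    refine ⟨N, fun n hn => ?_⟩
    obtain ⟨β, hβ, h⟩ := hN n hn
    exact ⟨β, hβ, ih β hβ _ _ _ _ (fun x => ⟨φ x.1, hm x.2.1, hm x.2.2⟩)
      (fun x y hxy => hm hxy) (fun x y hxy => hs hxy) h⟩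

theorem HasKdimO.of_strictMono {P Q : Type} [Preorder P] [Preorder Q] (φ : P → Q)
    (hm : Monotone φ) (hs : StrictMono φ) (h : HasKdimO Q) : HasKdimO P :=
  h.imp fun α => DevLE.of_strictMono α P Q _ _ φ hm hs

theorem DenselySplit.not_devLE (α : Ordinal.{0}) : ∀ (P : Type) (iP : Preorder P) (a b : P),
    DenselySplit a b → ¬ DevLE α P iP := by
  induction α using WellFoundedLT.induction with
  | _ α ih =>
    rintro P iP a b ⟨T, hlt, hd, hab⟩ hP
    rw [DevLE] at hP
    choose! g hg1 hg2 using hd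
    let f : ℕ → P := fun n => Nat.rec b (fun _ y => g a y) n
    have hf0 : ∀ n, T a (f n) := by
      intro n
      induction n with
      | zero => exact hab
      | succ n ihn => exact hg1 _ _ ihn
    have hf1 : ∀ n, T (f (n + 1)) (f n) := fun n => hg2 _ _ (hf0 n)
    obtain ⟨N, hN⟩ := hP f fun n => hlt _ _ (hf1 n)
    obtain ⟨β, hβ, h⟩ := hN N le_rfl
    refine ih β hβ _ _ ⟨f (N + 1), le_rfl, (hlt _ _ (hf1 N)).le⟩
      ⟨f N, (hlt _ _ (hf1 N)).le, le_rfl⟩ ⟨fun x y => T x.1 y.1, ?_, ?_, hf1 N⟩ h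
    · exact fun x y hxy => hlt _ _ hxy
    · intro x y hxy
      have h1 := hg1 _ _ hxy
      have h2 := hg2 _ _ hxy
      exact ⟨⟨g x.1 y.1, x.2.1.trans (hlt _ _ h1).le, (hlt _ _ h2).le.trans y.2.2⟩, h1, h2⟩

theorem exists_denselySplit_of_not_hasKdimO {P : Type} [Preorder P] (h : ¬ HasKdimO P) :
    ∃ a b : P, DenselySplit a b := by
  let K : P → P → Prop := fun x y => HasKdimO {z : P // x ≤ z ∧ z ≤ y}
  have Kmono : ∀ {x y x' y' : P}, K x y → x ≤ x' → y' ≤ y → K x' y' := by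
    intro x y x' y' hK hx hy
    exact HasKdimO.of_strictMono (fun z => ⟨z.1, hx.trans z.2.1, z.2.2.trans hy⟩)
      (fun _ _ h => h) (fun _ _ h => h) hK
  have hd : ∀ p : P × P, ∃ α : Ordinal.{0}, K p.1 p.2 →
      DevLE α {z : P // p.1 ≤ z ∧ z ≤ p.2} inferInstance := by
    intro p
    by_cases hp : K p.1 p.2
    · exact hp.imp fun α hα _ => hα
    · exact ⟨0, fun h => (hp h).elim⟩
  choose d hd using hd
  have hle : ∀ p, d p < Order.succ (⨆ p, d p) := fun p =>
    Order.lt_succ_of_le (Ordinal.le_iSup d p)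
  have hlt : ∀ x y : P, ¬ K x y → x < y := by
    intro x y hK
    by_contra hxy
    refine hK ⟨0, ?_⟩
    rw [DevLE]
    intro f hf
    exact (hxy ((f 1).2.1.trans_lt ((show (f 1).1 < (f 0).1 from hf 0).trans_le (f 0).2.2))).elim
  have hne : ∃ a b : P, ¬ K a b := by
    by_contra! hK
    refine h ⟨Order.succ (⨆ p, d p), ?_⟩
    rw [DevLE]
    intro f hf
    exact ⟨0, fun n _ => ⟨d (f (n + 1), f n), hle _, hd (f (n + 1), f n) (hK _ _)⟩⟩
  obtain ⟨a, b, hab⟩ := hne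
  refine ⟨a, b, fun x y => ¬ K x y, hlt, ?_, hab⟩
  intro x y hxy
  by_contra! hz
  refine hxy ⟨Order.succ (⨆ p, d p), ?_⟩
  rw [DevLE]
  intro f hf
  have hf' : ∀ n, (f (n + 1)).1 < (f n).1 := hf
  have hanti : Antitone fun n => (f n).1 := antitone_nat_of_succ_le fun n => (hf' n).le
  have key : ∃ N, ∀ n, N ≤ n → K (f (n + 1)).1 (f n).1 := by
    by_cases hall : ∀ n, K (f (n + 1)).1 (f n).1
    · exact ⟨0, fun n _ => hall n⟩
    · push Not at hall
      obtain ⟨n, hn⟩ := hall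
      have h1 : ¬ K (f (n + 1)).1 y := fun hK => hn (Kmono hK le_rfl (f n).2.2)
      have h2 : K x (f (n + 1)).1 := by
        by_contra h2
        exact h1 (hz _ h2)
      exact ⟨n + 1, fun m hm => Kmono h2 (f (m + 1)).2.1 (hanti hm)⟩
  obtain ⟨N, hN⟩ := key
  refine ⟨N, fun n hn => ⟨d ((f (n + 1)).1, (f n).1), hle _, ?_⟩⟩
  exact DevLE.of_strictMono _ _ _ _ _ (fun z => ⟨z.1.1, z.2.1, z.2.2⟩)
    (fun _ _ h => h) (fun _ _ h => h) (hd ((f (n + 1)).1, (f n).1) (hN n hn))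

theorem hasKdimO_iff_forall_not_denselySplit {P : Type} [Preorder P] :
    HasKdimO P ↔ ∀ a b : P, ¬ DenselySplit a b := by
  constructor
  · rintro ⟨α, hα⟩ a b hab
    exact hab.not_devLE α P _ a b hα
  · intro h
    by_contra hP
    obtain ⟨a, b, hab⟩ := exists_denselySplit_of_not_hasKdimO hP
    exact h a b hab

end Deviation

namespace DenselySplit

theorem lt {P : Type*} [Preorder P] {a b : P} (h : DenselySplit a b) : a < b := by
  obtain ⟨T, hlt, -, hab⟩ := h
  exact hlt _ _ hab

theorem exists_between {P : Type*} [Preorder P] {a b : P} (h : DenselySplit a b) :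
    ∃ c, DenselySplit a c ∧ DenselySplit c b := by
  obtain ⟨T, hlt, hd, hab⟩ := h
  obtain ⟨c, h1, h2⟩ := hd _ _ hab
  exact ⟨c, ⟨T, hlt, hd, h1⟩, ⟨T, hlt, hd, h2⟩⟩

theorem mono {P : Type*} [Preorder P] {a b a' b' : P} (h : DenselySplit a b) (ha : a' ≤ a)
    (hb : b ≤ b') : DenselySplit a' b' := by
  obtain ⟨T, hlt, hd, hab⟩ := h
  refine ⟨fun x y => ∃ u v, x ≤ u ∧ T u v ∧ v ≤ y, ?_, ?_, a, b, ha, hab, hb⟩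
  · rintro x y ⟨u, v, hx, hT, hy⟩
    exact (hx.trans_lt (hlt _ _ hT)).trans_le hy
  · rintro x y ⟨u, v, hx, hT, hy⟩
    obtain ⟨w, h1, h2⟩ := hd _ _ hT
    exact ⟨w, ⟨u, w, hx, h1, le_rfl⟩, ⟨w, v, le_rfl, h2, hy⟩⟩

theorem map_or {P Q R : Type*} [Preorder P] [PartialOrder Q] [PartialOrder R] {a b : P}
    (h : DenselySplit a b) {φ : P → Q} {ψ : P → R} (hφ : Monotone φ) (hψ : Monotone ψ)
    (hs : ∀ x y, a ≤ x → y ≤ b → x < y → φ x = φ y → ψ x ≠ ψ y) :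
    DenselySplit (φ a) (φ b) ∨ DenselySplit (ψ a) (ψ b) := by
  obtain ⟨T, hlt, hd, hab⟩ := h
  by_cases hc : ∃ x y, a ≤ x ∧ y ≤ b ∧ T x y ∧ φ x = φ y
  · obtain ⟨x, y, hx, hy, hT, he⟩ := hc
    right
    refine DenselySplit.mono (a := ψ x) (b := ψ y) ⟨fun p q => ∃ u v, x ≤ u ∧ v ≤ y ∧ T u v ∧
      p = ψ u ∧ q = ψ v, ?_, ?_, x, y, le_rfl, le_rfl, hT, rfl, rfl⟩ (hψ hx) (hψ hy)
    · rintro _ _ ⟨u, v, hu, hv, hT', rfl, rfl⟩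
      have huv := hlt _ _ hT'
      refine lt_of_le_of_ne (hψ huv.le) (hs u v (hx.trans hu) (hv.trans hy) huv ?_)
      exact le_antisymm (hφ huv.le) ((hφ hv).trans (he.symm.le.trans (hφ hu)))
    · rintro _ _ ⟨u, v, hu, hv, hT', rfl, rfl⟩
      obtain ⟨w, h1, h2⟩ := hd _ _ hT'
      exact ⟨ψ w, ⟨u, w, hu, (hlt _ _ h2).le.trans hv, h1, rfl, rfl⟩,
        ⟨w, v, hu.trans (hlt _ _ h1).le, hv, h2, rfl, rfl⟩⟩
  · left
    push Not at hc
    refine ⟨fun p q => ∃ u v, a ≤ u ∧ v ≤ b ∧ T u v ∧ p = φ u ∧ q = φ v, ?_, ?_,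
      a, b, le_rfl, le_rfl, hab, rfl, rfl⟩
    · rintro _ _ ⟨u, v, hu, hv, hT', rfl, rfl⟩
      exact lt_of_le_of_ne (hφ (hlt _ _ hT').le) (hc u v hu hv hT')
    · rintro _ _ ⟨u, v, hu, hv, hT', rfl, rfl⟩
      obtain ⟨w, h1, h2⟩ := hd _ _ hT'
      exact ⟨φ w, ⟨u, w, hu, (hlt _ _ h2).le.trans hv, h1, rfl, rfl⟩,
        ⟨w, v, hu.trans (hlt _ _ h1).le, hv, h2, rfl, rfl⟩⟩

theorem map {P Q : Type*} [Preorder P] [PartialOrder Q] {a b : P}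
    (h : DenselySplit a b) {φ : P → Q} (hφ : Monotone φ)
    (hs : ∀ x y, a ≤ x → y ≤ b → x < y → φ x ≠ φ y) : DenselySplit (φ a) (φ b) := by
  simpa using h.map_or hφ hφ fun x y hx hy hxy he => (hs x y hx hy hxy he).elim

theorem or_of_le {L : Type*} [Lattice L] [IsModularLattice L] {a b c : L} (h : DenselySplit a c)
    (hab : a ≤ b) (hbc : b ≤ c) : DenselySplit a b ∨ DenselySplit b c := by
  have := h.map_or (φ := fun x => x ⊓ b) (ψ := fun x => x ⊔ b)
    (fun x y hxy => inf_le_inf_right b hxy) (fun x y hxy => sup_le_sup_right hxy b)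
    (fun x y _ _ hxy h1 h2 => hxy.ne (eq_of_le_of_inf_le_of_sup_le hxy.le h1.ge h2.ge))
  simpa [inf_eq_left.2 hab, inf_eq_right.2 hbc, sup_eq_right.2 hab, sup_eq_left.2 hbc] using this

end DenselySplit

/-- An infinite independent family produces a densely ordered family of suprema. -/
theorem finDimL_of_forall_not_denselySplit {L : Type} [CompleteLattice L]
    (h : ∀ a b : L, ¬ DenselySplit a b) :
    FinDimL L := by
  rintro ⟨f, hne, hind⟩
  have hst : ∀ S U : Set ℕ, S ⊆ U → (U \ S).Infinite → ⨆ i ∈ S, f i < ⨆ i ∈ U, f i := by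
    intro S U hSU hinf
    obtain ⟨n, hnU, hnS⟩ := hinf.nonempty
    refine lt_of_le_of_ne (biSup_mono hSU) fun he => hne n ?_
    rw [← hind n, eq_comm, inf_eq_left]
    calc f n ≤ ⨆ i ∈ U, f i := le_biSup f hnU
      _ = ⨆ i ∈ S, f i := he.symm
      _ ≤ ⨆ m, ⨆ _ : m ≠ n, f m := biSup_mono fun i hi hin => hnS (hin ▸ hi)
  refine h _ _ ⟨fun x y => ∃ S U : Set ℕ, S ⊆ U ∧ (U \ S).Infinite ∧ x = ⨆ i ∈ S, f i ∧
    y = ⨆ i ∈ U, f i, ?_, ?_, ∅, Set.univ, Set.empty_subset _, ?_, rfl, rfl⟩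
  · rintro _ _ ⟨S, U, hSU, hinf, rfl, rfl⟩
    exact hst S U hSU hinf
  · rintro _ _ ⟨S, U, hSU, hinf, rfl, rfl⟩
    let g := Set.Infinite.natEmbedding _ hinf
    have hg : ∀ k, (g k).1 ∈ U \ S := fun k => (g k).2
    have hinj : Function.Injective fun k => (g k).1 := fun a b hab => g.injective (Subtype.ext hab)
    let W : Set ℕ := S ∪ Set.range fun k => (g (2 * k)).1
    refine ⟨_, ⟨S, W, Set.subset_union_left, ?_, rfl, rfl⟩, ⟨W, U, ?_, ?_, rfl, rfl⟩⟩
    · refine Set.infinite_of_injective_forall_mem (f := fun k => (g (2 * k)).1) ?_ ?_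
      · intro a b hab
        have := hinj hab
        omega
      · exact fun k => ⟨Or.inr ⟨k, rfl⟩, (hg _).2⟩
    · rintro i (hi | ⟨k, rfl⟩)
      exacts [hSU hi, (hg _).1]
    · refine Set.infinite_of_injective_forall_mem (f := fun k => (g (2 * k + 1)).1) ?_ ?_
      · intro a b hab
        have := hinj hab
        omega
      · refine fun k => ⟨(hg _).1, ?_⟩
        rintro (hi | ⟨l, hl⟩)
        · exact (hg _).2 hi
        · have := hinj hl
          omega
  · simpa using Set.infinite_univ

section Arithmetical

variable {A : Type} [CommRing A]

/-- In an arithmetical ring, any two elements are locally comparable for divisibility. -/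
theorem Arithmetical.exists_mul_eq (ha : Arithmetical A) (a b : A) :
    ∃ e f c d : A, e + f = 1 ∧ e * a = c * b ∧ f * b = d * a := by
  have h := ha (Ideal.span {a}) (Ideal.span {b}) (Ideal.span {a - b})
  have hmem : a ∈ Ideal.span {a} ⊓ (Ideal.span {b} ⊔ Ideal.span {a - b}) := by
    refine ⟨Ideal.mem_span_singleton_self a, ?_⟩
    have := Submodule.add_mem_sup (Ideal.mem_span_singleton_self b)
      (Ideal.mem_span_singleton_self (a - b))
    simpa using this
  rw [h] at hmem
  obtain ⟨x, hx, y, hy, hxy⟩ := Submodule.mem_sup.1 hmem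
  obtain ⟨c, hc⟩ := Ideal.mem_span_singleton'.1 hx.2
  obtain ⟨d, hd⟩ := Ideal.mem_span_singleton'.1 hy.2
  obtain ⟨z, hz⟩ := Ideal.mem_span_singleton'.1 hy.1
  exact ⟨1 - d, d, c - d, d - z, by ring, by linear_combination -hxy - hc - hd,
    by linear_combination hz - hd⟩

theorem Arithmetical.sup_inf_sup_le (ha : Arithmetical A) (u x y : Ideal A) :
    (u ⊔ x) ⊓ (u ⊔ y) ≤ u ⊔ x ⊓ y := by
  rw [ha, inf_comm (u ⊔ x) y, ha]
  exact sup_le (inf_le_right.trans le_sup_left)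
    (sup_le (inf_le_right.trans le_sup_left) (inf_comm y x ▸ le_sup_right))

theorem DenselySplit.or_of_inf_le (ha : Arithmetical A) {C B X Y : Ideal A} (h : DenselySplit C B)
    (hXY : X ⊓ Y ≤ C) : DenselySplit (C ⊔ X) (B ⊔ X) ∨ DenselySplit (C ⊔ Y) (B ⊔ Y) := by
  refine h.map_or (φ := fun U => U ⊔ X) (ψ := fun U => U ⊔ Y)
    (fun x y hxy => sup_le_sup_right hxy X) (fun x y hxy => sup_le_sup_right hxy Y) ?_
  intro U V hU _ hUV h1 h2
  refine hUV.not_ge ?_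
  calc V ≤ (U ⊔ X) ⊓ (U ⊔ Y) :=
        le_inf (le_sup_left.trans h1.ge) (le_sup_left.trans h2.ge)
    _ ≤ U ⊔ X ⊓ Y := ha.sup_inf_sup_le U X Y
    _ ≤ U := sup_le le_rfl (hXY.trans hU)

/-- The pseudocomplement of `U` relative to `C`: the largest ideal `W` with `W ⊓ U ≤ C`. -/
def pseudoCompl (ha : Arithmetical A) (C U : Ideal A) : Ideal A where
  carrier := {a | Ideal.span {a} ⊓ U ≤ C}
  zero_mem' := by simp
  add_mem' := by
    intro a b h1 h2
    have h : Ideal.span {a + b} ≤ Ideal.span {a} ⊔ Ideal.span {b} := by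
      rw [Ideal.span_singleton_le_iff_mem]
      exact Submodule.add_mem_sup (Ideal.mem_span_singleton_self a)
        (Ideal.mem_span_singleton_self b)
    refine (inf_le_inf_right U h).trans ?_
    rw [inf_comm, ha, inf_comm U, inf_comm U]
    exact sup_le h1 h2
  smul_mem' := by
    intro c a h
    refine (inf_le_inf_right U ?_).trans h
    rw [Ideal.span_singleton_le_iff_mem]
    exact Ideal.mul_mem_left _ c (Ideal.mem_span_singleton_self a)

theorem le_pseudoCompl_iff (ha : Arithmetical A) {C U W : Ideal A} :
    W ≤ pseudoCompl ha C U ↔ W ⊓ U ≤ C := by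
  constructor
  · rintro h x ⟨hW, hU⟩
    exact h hW ⟨Ideal.mem_span_singleton_self x, hU⟩
  · intro h x hx
    exact (inf_le_inf_right U ((Ideal.span_singleton_le_iff_mem W).2 hx)).trans h

theorem FinDimL.not_exists_disjoint (ha : Arithmetical A) {C : Ideal A}
    (hC : FinDimL (Ideal (A ⧸ C))) (V : ℕ → Ideal A) (hV : ∀ n, ¬ V n ≤ C)
    (hd : ∀ m n, m ≠ n → V m ⊓ V n ≤ C) : False := by
  refine hC ⟨fun n => (V n).map (Ideal.Quotient.mk C), fun n h0 => hV n ?_, fun n => ?_⟩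
  · rwa [Ideal.map_eq_bot_iff_le_ker, Ideal.mk_ker] at h0
  · rw [eq_bot_iff]
    have hle : (⨆ m, ⨆ _ : m ≠ n, (V m).map (Ideal.Quotient.mk C)) ≤
        (pseudoCompl ha C (V n)).map (Ideal.Quotient.mk C) :=
      iSup₂_le fun m hm => Ideal.map_mono ((le_pseudoCompl_iff ha).2 (hd m n hm))
    refine (inf_le_inf_left _ hle).trans ?_
    rintro x ⟨h1, h2⟩
    obtain ⟨v, hv, rfl⟩ :=
      (Ideal.mem_map_iff_of_surjective _ Ideal.Quotient.mk_surjective).1 h1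
    obtain ⟨w, hw, hvw⟩ :=
      (Ideal.mem_map_iff_of_surjective _ Ideal.Quotient.mk_surjective).1 h2
    have hC' : C ≤ pseudoCompl ha C (V n) := (le_pseudoCompl_iff ha).2 inf_le_left
    have hmem : v ∈ pseudoCompl ha C (V n) := by
      have := (pseudoCompl ha C (V n)).sub_mem hw (hC' (Ideal.Quotient.eq.1 hvw))
      simpa using this
    exact Ideal.Quotient.eq_zero_iff_mem.2 ((le_pseudoCompl_iff ha).1 le_rfl ⟨hmem, hv⟩)

theorem DenselySplit.exists_infPrime (ha : Arithmetical A) {C B : Ideal A}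
    (hC : FinDimL (Ideal (A ⧸ C))) (h : DenselySplit C B) :
    ∃ J, C ≤ J ∧ InfPrime J ∧ DenselySplit J (B ⊔ J) := by
  let p : Ideal A → Ideal A := pseudoCompl ha C
  let G : Ideal A → Prop := fun U => DenselySplit (p U) (B ⊔ p U)
  have hp : ∀ {U W : Ideal A}, W ≤ p U ↔ W ⊓ U ≤ C := le_pseudoCompl_iff ha
  have hCp : ∀ U, C ≤ p U := fun U => hp.2 inf_le_left
  have hGC : ∀ U, G U → ¬ U ≤ C := by
    intro U hU hUC
    have : p U = ⊤ := top_le_iff.1 (hp.2 (inf_le_right.trans hUC))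
    exact not_top_lt (this ▸ hU.lt)
  by_cases hun : ∃ U, G U ∧ ∀ V W, V ≤ U → W ≤ U → V ⊓ W ≤ C → V ≤ C ∨ W ≤ C
  · obtain ⟨U, hU, hprime⟩ := hun
    refine ⟨p U, hCp U, ⟨fun hmax => hmax.not_lt hU.lt, fun X Y hXY => ?_⟩, hU⟩
    rw [hp] at hXY
    rw [hp, hp]
    refine hprime _ _ inf_le_right inf_le_right (le_trans ?_ hXY)
    exact le_inf (inf_le_inf inf_le_left inf_le_left) (inf_le_left.trans inf_le_right)
  · exfalso
    push Not at hun
    have step : ∀ U, G U → ∃ U' V, G U' ∧ U' ≤ U ∧ V ≤ U ∧ ¬ V ≤ C ∧ V ⊓ U' ≤ C := by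
      intro U hU
      obtain ⟨V, W, hV, hW, hVW, hVC, hWC⟩ := hun U hU
      have hdisj : p V ⊓ p (p V ⊓ U) ≤ p U := by
        rw [hp]
        refine le_trans ?_ (hp.1 (le_refl (p (p V ⊓ U))))
        exact le_inf (inf_le_left.trans inf_le_right)
          (inf_le_inf_right U inf_le_left)
      have anti : ∀ {X}, X ≤ U → p U ≤ p X := fun hX =>
        hp.2 ((inf_le_inf_left _ hX).trans (hp.1 le_rfl))
      have hVp : V ⊓ (p V ⊓ U) ≤ C :=
        (le_inf (inf_le_right.trans inf_le_left) inf_le_left).trans (hp.1 (le_refl (p V)))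
      rcases DenselySplit.or_of_inf_le ha hU hdisj with h1 | h1
      · rw [sup_assoc, sup_eq_right.2 (anti hV)] at h1
        refine ⟨V, W, h1, hV, hW, hWC, by rwa [inf_comm]⟩
      · rw [sup_assoc, sup_eq_right.2 (anti inf_le_right)] at h1
        exact ⟨p V ⊓ U, V, h1, inf_le_right, hV, hVC, hVp⟩
    choose! g k hg hgU hk hkC hkg using step
    have hG0 : G ⊤ := by
      have : p ⊤ = C := le_antisymm (by simpa using hp.1 (le_refl (p ⊤))) (hCp _)
      show DenselySplit (p ⊤) (B ⊔ p ⊤)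
      rw [this]
      exact h.mono le_rfl le_sup_left
    let U : ℕ → Ideal A := fun n => Nat.rec ⊤ (fun _ X => g X) n
    have hUG : ∀ n, G (U n) := by
      intro n
      induction n with
      | zero => exact hG0
      | succ n ih => exact hg _ ih
    have hanti : Antitone U := antitone_nat_of_succ_le fun n => hgU _ (hUG n)
    have hlt : ∀ m n, m < n → k (U m) ⊓ k (U n) ≤ C := fun m n hmn =>
      (inf_le_inf_left _ ((hk _ (hUG n)).trans (hanti hmn))).trans (hkg _ (hUG m))
    refine hC.not_exists_disjoint ha (fun n => k (U n)) (fun n => hkC _ (hUG n)) ?_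
    intro m n hmn
    rcases lt_or_gt_of_ne hmn with h' | h'
    · exact hlt m n h'
    · rw [inf_comm]
      exact hlt n m h'

theorem NoIdemEss.not_le_mul_self {J B : Ideal A} (hJ : NoIdemEss (A ⧸ J)) (hp : InfPrime J)
    (hJB : J < B) (hB : B ≠ ⊤) : ¬ B ≤ B * B ⊔ J := by
  intro hle
  have hs := Ideal.Quotient.mk_surjective (I := J)
  have hcm : (B.map (Ideal.Quotient.mk J)).comap (Ideal.Quotient.mk J) = B := by
    rw [Ideal.comap_map_of_surjective' _ hs, Ideal.mk_ker, sup_eq_left.2 hJB.le]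
  have hbot : (⊥ : Ideal (A ⧸ J)).comap (Ideal.Quotient.mk J) = J := Ideal.mk_ker
  refine hJ (B.map (Ideal.Quotient.mk J)) ?_ ?_ ?_
  · intro h
    rw [h, Ideal.comap_top] at hcm
    exact hB hcm.symm
  · intro C hC h
    have h1 := congrArg (Ideal.comap (Ideal.Quotient.mk J)) h
    rw [Ideal.comap_inf, hcm, hbot] at h1
    rcases hp.2 h1.le with h2 | h2
    · exact hJB.not_ge h2
    · refine hC (eq_bot_iff.2 ?_)
      rw [← Ideal.map_comap_of_surjective _ hs C]
      exact (Ideal.map_mono h2).trans (by rw [Ideal.map_quotient_self])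
  · rw [← Ideal.map_mul]
    refine le_antisymm (Ideal.map_mono Ideal.mul_le_left) ?_
    refine (Ideal.map_mono hle).trans ?_
    rw [Ideal.map_sup, Ideal.map_quotient_self, sup_bot_eq]

theorem InfPrime.of_isPrime {P : Ideal A} (hP : P.IsPrime) : InfPrime P :=
  ⟨fun h => hP.ne_top h.eq_top, fun _ _ h => (Ideal.IsPrime.inf_le hP).1 h⟩

theorem Ideal.mem_of_isCoprime_of_mul_mem {Z : Ideal A} {e f x : A} (h : IsCoprime e f)
    (he : e * x ∈ Z) (hf : f * x ∈ Z) : x ∈ Z := by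
  obtain ⟨u, v, huv⟩ := h
  have : x = u * (e * x) + v * (f * x) := by linear_combination -x * huv
  rw [this]
  exact Z.add_mem (Z.mul_mem_left _ he) (Z.mul_mem_left _ hf)

theorem InfPrime.mem_or_mem_of_isCoprime {J : Ideal A} (hJ : InfPrime J) {e f x y : A}
    (h : IsCoprime e f) (hx : e * x ∈ J) (hy : f * y ∈ J) : x ∈ J ∨ y ∈ J := by
  suffices hle : Ideal.span {x} ⊓ Ideal.span {y} ≤ J by
    simpa only [Ideal.span_singleton_le_iff_mem] using hJ.2 hle
  rintro z ⟨hzx, hzy⟩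
  obtain ⟨u, rfl⟩ := Ideal.mem_span_singleton'.1 hzx
  obtain ⟨v, hv⟩ := Ideal.mem_span_singleton'.1 hzy
  refine Ideal.mem_of_isCoprime_of_mul_mem h ?_ ?_
  · rw [mul_left_comm]
    exact J.mul_mem_left _ hx
  · rw [← hv, mul_left_comm]
    exact J.mul_mem_left _ hy

/-- For a prime element `J` of the lattice of ideals, the radical of `(J : b)` is prime. -/
theorem InfPrime.pow_mul_mem_or (ha : Arithmetical A) {J : Ideal A} (hJ : InfPrime J)
    {u v b : A} {n : ℕ} (h : (u * v) ^ n * b ∈ J) :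
    (∃ m, u ^ m * b ∈ J) ∨ ∃ m, v ^ m * b ∈ J := by
  obtain ⟨e, f, c, d, hef, hu, hv⟩ := ha.exists_mul_eq (u ^ n) (v ^ n)
  have hco : IsCoprime e f := ⟨1, 1, by simpa using hef⟩
  have h1 : e * (u ^ (2 * n) * b) ∈ J := by
    have : e * (u ^ (2 * n) * b) = c * ((u * v) ^ n * b) := by
      rw [mul_pow]
      linear_combination (u ^ n * b) * hu
    exact this ▸ J.mul_mem_left _ h
  have h2 : f * (v ^ (2 * n) * b) ∈ J := by
    have : f * (v ^ (2 * n) * b) = d * ((u * v) ^ n * b) := by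
      rw [mul_pow]
      linear_combination (v ^ n * b) * hv
    exact this ▸ J.mul_mem_left _ h
  exact (hJ.mem_or_mem_of_isCoprime hco h1 h2).imp (fun h => ⟨_, h⟩) fun h => ⟨_, h⟩

theorem InfPrime.isPrime_radical (ha : Arithmetical A) {J : Ideal A} (hJ : InfPrime J) :
    J.radical.IsPrime := by
  refine ⟨fun h => hJ.1 ?_, fun {x y} h => ?_⟩
  · rw [Ideal.radical_eq_top] at h
    exact h ▸ isMax_top
  · obtain ⟨n, hn⟩ := h
    simpa [Ideal.mem_radical_iff] using
      hJ.pow_mul_mem_or ha (b := 1) (n := n) (by simpa using hn)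

theorem not_denselySplit_span_singleton_sup {P J : Ideal A} (hP : ¬ DenselySplit P ⊤) {y : A}
    (hy : ∀ p ∈ P, p * y ∈ J) : ¬ DenselySplit J (Ideal.span {y} ⊔ J) := by
  intro h
  let φ : Ideal A → Ideal A := fun Z => Submodule.comap (LinearMap.toSpanSingleton A A y) Z
  have hφ : Monotone φ := fun X Y hXY => Submodule.comap_mono hXY
  refine hP ((h.map hφ ?_).mono (fun p hp => hy p hp) le_top)
  intro X Y hX hY hXY he
  refine hXY.not_ge fun z hz => ?_
  obtain ⟨w, hw, j, hj, rfl⟩ := Submodule.mem_sup.1 (hY hz)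
  obtain ⟨a, rfl⟩ := Ideal.mem_span_singleton'.1 hw
  refine X.add_mem ?_ (hX hj)
  have h1 : a ∈ φ Y := (Y.add_mem_iff_left (hXY.le (hX hj))).1 hz
  rw [← he] at h1
  exact h1

/-- Proper subobjects of a uniform, torsion, divisible subquotient are contained in
cyclic ones. -/
theorem InfPrime.exists_le_span_singleton_sup (ha : Arithmetical A) {J B X P : Ideal A}
    (hJ : InfPrime J) (hdiv : ∀ s ∉ P, ∀ b ∈ B, ∃ b' ∈ B, b - s * b' ∈ J)
    (htor : ∀ b ∈ B, ∃ s ∉ P, s * b ∈ J) (hJX : J ≤ X) (hXB : X < B) :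
    ∃ y ∈ B, X ≤ Ideal.span {y} ⊔ J := by
  obtain ⟨b, hbB, hbX⟩ := SetLike.exists_of_lt hXB
  obtain ⟨r, hr, hrb⟩ := htor b hbB
  obtain ⟨y, hyB, hby⟩ := hdiv r hr b hbB
  have hrr : r ^ 2 * y ∈ J := by
    have : r ^ 2 * y = r * b - r * (b - r * y) := by ring
    exact this ▸ J.sub_mem hrb (J.mul_mem_left _ hby)
  have hyJ : y ∉ J := by
    intro hy
    have : b = (b - r * y) + r * y := by ring
    exact hbX (this ▸ hJX (J.add_mem hby (J.mul_mem_left _ hy)))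
  refine ⟨y, hyB, fun x hx => ?_⟩
  have hJy : J ≤ Ideal.span {y} ⊔ J := le_sup_right
  by_cases hxJ : x ∈ J
  · exact hJy hxJ
  obtain ⟨e, f, c, d, hef, hex, hfy⟩ := ha.exists_mul_eq x y
  have hco : IsCoprime e f := ⟨1, 1, by simpa using hef⟩
  have hexy : e * x ∈ Ideal.span {y} ⊔ J := by
    rw [hex]
    exact Ideal.mem_sup_left (Ideal.mul_mem_left _ _ (Ideal.mem_span_singleton_self y))
  have hf : ∃ n, f ^ n * y ∈ J := by
    obtain ⟨e', f', c', d', hef', hr', hf'⟩ := ha.exists_mul_eq r f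
    have hco' : IsCoprime e' f' := ⟨1, 1, by simpa using hef'⟩
    have h1 : (f' * f) ^ 2 * y ∈ J := by
      have : (f' * f) ^ 2 * y = d' ^ 2 * (r ^ 2 * y) := by
        rw [hf']
        ring
      exact this ▸ J.mul_mem_left _ hrr
    refine (hJ.pow_mul_mem_or ha h1).resolve_left ?_
    rintro ⟨m, hm⟩
    refine hbX (Ideal.mem_of_isCoprime_of_mul_mem (hco'.pow_right (n := m)) ?_ ?_)
    · have : e' * b = c' * (d * x) + e' * (b - r * y) := by
        linear_combination y * hr' + c' * hfy
      exact this ▸ X.add_mem (X.mul_mem_left _ (X.mul_mem_left _ hx))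
        (X.mul_mem_left _ (hJX hby))
    · have : f' ^ m * b = r * (f' ^ m * y) + f' ^ m * (b - r * y) := by ring
      exact hJX (this ▸ J.add_mem (J.mul_mem_left _ hm) (J.mul_mem_left _ hby))
  obtain ⟨n, hn⟩ := hf
  have h2 : (f * e) ^ (n + 1) * x ∈ J := by
    have : (f * e) ^ (n + 1) * x = (f * e ^ n * c) * (f ^ n * y) := by
      rw [mul_pow, pow_succ e]
      linear_combination f ^ (n + 1) * e ^ n * hex
    exact this ▸ J.mul_mem_left _ hn
  rcases hJ.pow_mul_mem_or ha h2 with ⟨m, hm⟩ | ⟨m, hm⟩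
  · exact Ideal.mem_of_isCoprime_of_mul_mem (hco.pow_right (n := m)) hexy (hJy hm)
  · exact ((hJ.mem_or_mem_of_isCoprime (hco.pow (m := m) (n := n)) hm hn).elim hxJ hyJ).elim

theorem not_denselySplit_of_divisible (ha : Arithmetical A)
    (hfd : ∀ I : Ideal A, FinDimL (Ideal (A ⧸ I))) {P B C : Ideal A}
    (hPT : ¬ DenselySplit P ⊤) (hPB : ∀ p ∈ P, ∀ b ∈ B, p * b ∈ C)
    (hdiv : ∀ s ∉ P, ∀ b ∈ B, ∃ b' ∈ B, b - s * b' ∈ C) : ¬ DenselySplit C B := by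
  intro h
  obtain ⟨Y, hCY, hYB⟩ := h.exists_between
  obtain ⟨J, hYJ, hJ, hJB⟩ := hYB.exists_infPrime ha (hfd Y)
  have hCJ : C ≤ J := hCY.lt.le.trans hYJ
  obtain ⟨y, hyY, hyC⟩ := SetLike.exists_of_lt hCY.lt
  have hyB : y ∈ B := hYB.lt.le hyY
  have hPB' : ∀ p ∈ P, ∀ b ∈ B ⊔ J, p * b ∈ J := by
    intro p hp b hb
    obtain ⟨d, hd, j, hj, rfl⟩ := Submodule.mem_sup.1 hb
    rw [mul_add]
    exact J.add_mem (hCJ (hPB p hp d hd)) (J.mul_mem_left _ hj)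
  have hdiv' : ∀ s ∉ P, ∀ b ∈ B ⊔ J, ∃ b' ∈ B ⊔ J, b - s * b' ∈ J := by
    intro s hs b hb
    obtain ⟨d, hd, j, hj, rfl⟩ := Submodule.mem_sup.1 hb
    obtain ⟨b', hb', h'⟩ := hdiv s hs d hd
    refine ⟨b', Ideal.mem_sup_left hb', ?_⟩
    have : d + j - s * b' = (d - s * b') + j := by ring
    exact this ▸ J.add_mem (hCJ h') hj
  have htor : ∀ b ∈ B, ∃ s ∉ P, s * b ∈ J := by
    intro b hb
    obtain ⟨e, f, c, d, hef, hy, hb'⟩ := ha.exists_mul_eq y b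
    by_cases hf : f ∈ P
    · refine ⟨c, fun hc => hyC ?_, ?_⟩
      · have : y = c * b + f * y := by linear_combination hy - y * hef
        exact this ▸ C.add_mem (hPB c hc b hb) (hPB f hf y hyB)
      · have : c * b = y - f * y := by linear_combination -hy + y * hef
        exact this ▸ J.sub_mem (hYJ hyY) (J.mul_mem_left _ (hYJ hyY))
    · exact ⟨f, hf, hb' ▸ J.mul_mem_left _ (hYJ hyY)⟩
  have htor' : ∀ b ∈ B ⊔ J, ∃ s ∉ P, s * b ∈ J := by
    intro b hb
    obtain ⟨d, hd, j, hj, rfl⟩ := Submodule.mem_sup.1 hb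
    obtain ⟨s, hs, h'⟩ := htor d hd
    exact ⟨s, hs, mul_add s d j ▸ J.add_mem h' (J.mul_mem_left _ hj)⟩
  obtain ⟨X, hJX, hXB⟩ := hJB.exists_between
  obtain ⟨z, hz, hXz⟩ := hJ.exists_le_span_singleton_sup ha hdiv' htor' hJX.lt.le hXB.lt
  exact not_denselySplit_span_singleton_sup hPT (fun p hp => hPB' p hp z hz) (hJX.mono le_rfl hXz)

theorem InfPrime.exists_pow_radical_le (ha : Arithmetical A) {J : Ideal A} (hJ : InfPrime J)
    (hid : NoIdemEss (A ⧸ J)) (hdiv : ∀ s ∉ J.radical, ∀ p ∈ J.radical,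
      ∃ p' ∈ J.radical, p - s * p' ∈ J) : ∃ m, J.radical ^ m ≤ J := by
  set P := J.radical with hPdef
  have hP : P.IsPrime := hJ.isPrime_radical ha
  rcases J.le_radical.eq_or_lt with heq | hlt
  · exact ⟨1, by rw [pow_one, hPdef, ← heq]⟩
  obtain ⟨x, hxP, hx⟩ := SetLike.not_le_iff_exists.1 (hid.not_le_mul_self hJ hlt hP.ne_top)
  obtain ⟨n, hn⟩ := id hxP
  have hx2 : x ∉ P * P := fun h => hx (Ideal.mem_sup_left h)
  have hbase : ∀ z ∈ P * P, ∃ e ∉ P, e * z ∈ Ideal.span {x} := by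
    intro z hz
    obtain ⟨e, f, c, d, hef, hz', hx'⟩ := ha.exists_mul_eq z x
    refine ⟨e, fun he => hx2 ?_, hz' ▸ Ideal.mul_mem_left _ _ (Ideal.mem_span_singleton_self x)⟩
    have : x = e * x + d * z := by linear_combination hx' - x * hef
    exact this ▸ (P * P).add_mem (Ideal.mul_mem_mul he hxP) (Ideal.mul_mem_left _ _ hz)
  have hpow : ∀ k, ∀ z ∈ (P * P) ^ k, ∃ e ∉ P, e * z ∈ Ideal.span {x ^ k} := by
    intro k
    induction k with
    | zero => exact fun z _ => ⟨1, fun h => hP.ne_top (P.eq_top_of_isUnit_mem h isUnit_one), by simp⟩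
    | succ k ih =>
      intro z hz
      rw [pow_succ] at hz
      induction hz using Submodule.mul_induction_on' with
      | mem_mul_mem u hu v hv =>
        obtain ⟨e, he, h1⟩ := ih u hu
        obtain ⟨f, hf, h2⟩ := hbase v hv
        refine ⟨e * f, fun h => (hP.mem_or_mem h).elim he hf, ?_⟩
        have := Ideal.mul_mem_mul h1 h2
        rw [Ideal.span_singleton_mul_span_singleton, ← pow_succ] at this
        rwa [mul_mul_mul_comm]
      | add u _ v _ hu hv =>
        obtain ⟨e, he, h1⟩ := hu
        obtain ⟨f, hf, h2⟩ := hv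
        refine ⟨e * f, fun h => (hP.mem_or_mem h).elim he hf, ?_⟩
        have : e * f * (u + v) = f * (e * u) + e * (f * v) := by ring
        exact this ▸ Ideal.add_mem _ (Ideal.mul_mem_left _ _ h1) (Ideal.mul_mem_left _ _ h2)
  refine ⟨2 * n + 1, ?_⟩
  rw [pow_succ, pow_mul, pow_two, Ideal.mul_le]
  intro z hz p hp
  obtain ⟨e, he, hez⟩ := hpow n z hz
  obtain ⟨p', hp', hpp⟩ := hdiv e he p hp
  have hezJ : e * z ∈ J := (Ideal.span_singleton_le_iff_mem J).2 hn hez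
  have : z * p = z * (p - e * p') + p' * (e * z) := by ring
  exact this ▸ J.add_mem (J.mul_mem_left _ hpp) (J.mul_mem_left _ hezJ)

theorem InfPrime.radical_divisible (ha : Arithmetical A) {J : Ideal A} (hJ : InfPrime J)
    (s : A) (hs : s ∉ J.radical) (p : A) (hp : p ∈ J.radical) :
    ∃ p' ∈ J.radical, p - s * p' ∈ J := by
  have hP := hJ.isPrime_radical ha
  obtain ⟨e, f, c, d, hef, hp', hs'⟩ := ha.exists_mul_eq p s
  have hf : f ∈ J.radical :=
    (hP.mem_or_mem (hs' ▸ J.radical.mul_mem_left _ hp)).resolve_right hs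
  have hc : c ∈ J.radical :=
    (hP.mem_or_mem (hp' ▸ J.radical.mul_mem_left _ hp)).resolve_right hs
  obtain ⟨n, hn⟩ := hf
  have hco : IsCoprime e (f ^ n) := IsCoprime.pow_right ⟨1, 1, by simpa using hef⟩
  obtain ⟨u, v, huv⟩ := hco
  refine ⟨u * c, J.radical.mul_mem_left _ hc, ?_⟩
  have : p - s * (u * c) = v * p * f ^ n := by linear_combination -p * huv + u * hp'
  exact this ▸ J.mul_mem_left _ hn

theorem InfPrime.not_denselySplit_top (ha : Arithmetical A)
    (hfd : ∀ I : Ideal A, FinDimL (Ideal (A ⧸ I))) {J : Ideal A} (hid : NoIdemEss (A ⧸ J))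
    (hJ : InfPrime J) (hPT : ¬ DenselySplit J.radical ⊤) : ¬ DenselySplit J ⊤ := by
  have hdiv := hJ.radical_divisible ha
  obtain ⟨m, hm⟩ := hJ.exists_pow_radical_le ha hid hdiv
  have key : ∀ i, ¬ DenselySplit (J.radical ^ (i + 1) ⊔ J) ⊤ := by
    intro i
    induction i with
    | zero => rwa [zero_add, pow_one, sup_eq_left.2 J.le_radical]
    | succ i ih =>
      intro h
      have hle : J.radical ^ (i + 1 + 1) ⊔ J ≤ J.radical ^ (i + 1) ⊔ J :=
        sup_le_sup_right (Ideal.pow_le_pow_right (Nat.le_succ _)) J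
      refine (h.or_of_le hle le_top).elim ?_ ih
      refine not_denselySplit_of_divisible ha hfd hPT ?_ ?_
      · intro p hp b hb
        obtain ⟨d, hd, j, hj, rfl⟩ := Submodule.mem_sup.1 hb
        rw [mul_add]
        refine Ideal.add_mem _ (Ideal.mem_sup_left ?_)
          (Ideal.mem_sup_right (J.mul_mem_left _ hj))
        rw [pow_succ' _ (i + 1)]
        exact Ideal.mul_mem_mul hp hd
      · intro s hs b hb
        have hle : J.radical ^ (i + 1) ≤ Ideal.span {s} * J.radical ^ (i + 1) ⊔ J := by
          have h1 : J.radical ≤ Ideal.span {s} * J.radical ⊔ J := by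
            intro p hp
            obtain ⟨p', hp', hpp⟩ := hdiv s hs p hp
            have : p = s * p' + (p - s * p') := by ring
            exact this ▸ Submodule.add_mem_sup
              (Ideal.mul_mem_mul (Ideal.mem_span_singleton_self s) hp') hpp
          rw [pow_succ']
          refine (Ideal.mul_mono_left h1).trans ?_
          rw [Ideal.sup_mul, mul_assoc]
          exact sup_le_sup_left Ideal.mul_le_left _
        obtain ⟨w, hw, j, hj, rfl⟩ := Submodule.mem_sup.1 ((sup_le hle le_sup_right) hb)
        obtain ⟨b', hb', rfl⟩ := Ideal.mem_span_singleton_mul.1 hw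
        refine ⟨b', Ideal.mem_sup_left hb', ?_⟩
        simpa using Ideal.mem_sup_right hj
  intro h
  refine key m (h.mono (sup_le ?_ le_rfl) le_rfl)
  exact (Ideal.pow_le_pow_right (Nat.le_succ m)).trans hm

theorem exists_maximal_denselySplit_prime (ha : Arithmetical A)
    (hid : ∀ I : Ideal A, NoIdemEss (A ⧸ I)) {P : Ideal A} (hP : P.IsPrime)
    (hPT : DenselySplit P ⊤) :
    ∃ M : Ideal A, Maximal (fun Q : Ideal A => Q.IsPrime ∧ DenselySplit Q ⊤) M := by
  suffices h : _ from
    (zorn_le_nonempty₀ {Q : Ideal A | Q.IsPrime ∧ DenselySplit Q ⊤} h P ⟨hP, hPT⟩).imp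
      fun _ hM => hM.2
  intro c hcS hc Q hQ
  by_cases hmem : sSup c ∈ c
  · exact ⟨sSup c, hcS hmem, fun Z hZ => le_sSup hZ⟩
  exfalso
  have hdir := hc.directedOn
  have hsup : ∀ x, x ∈ sSup c ↔ ∃ Z ∈ c, x ∈ Z := fun x =>
    Submodule.mem_sSup_of_directed ⟨Q, hQ⟩ hdir
  have hQlt : ∀ Z ∈ c, Z < sSup c := fun Z hZ =>
    lt_of_le_of_ne (le_sSup hZ) fun h => hmem (h ▸ hZ)
  refine (hid Q).not_le_mul_self (InfPrime.of_isPrime (hcS hQ).1) (hQlt Q hQ) ?_ ?_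
  · intro htop
    obtain ⟨Z, hZ, h1⟩ := (hsup 1).1 (htop ▸ Submodule.mem_top)
    exact (hcS hZ).1.ne_top ((Ideal.eq_top_iff_one Z).2 h1)
  · refine le_trans (fun x hx => ?_) le_sup_left
    obtain ⟨Z, hZ, hxZ⟩ := (hsup x).1 hx
    obtain ⟨s, hs, hsZ⟩ := SetLike.exists_of_lt (hQlt Z hZ)
    obtain ⟨e, f, u, v, hef, hx', hs'⟩ := ha.exists_mul_eq x (s * s)
    have hf : f ∈ Z := by
      have : f * (s * s) ∈ Z := hs' ▸ Z.mul_mem_left _ hxZ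
      have hZp := (hcS hZ).1
      exact (hZp.mem_or_mem this).resolve_right fun h => (hZp.mem_or_mem h).elim hsZ hsZ
    have : x = u * (s * s) + f * x := by linear_combination hx' - x * hef
    exact this ▸ Ideal.add_mem _ (Ideal.mul_mem_left _ _ (Ideal.mul_mem_mul hs hs))
      (Ideal.mul_mem_mul (le_sSup hZ hf) hx)

theorem not_denselySplit_of_finDimL_of_noIdemEss (ha : Arithmetical A)
    (hfd : ∀ I : Ideal A, FinDimL (Ideal (A ⧸ I)))
    (hid : ∀ I : Ideal A, NoIdemEss (A ⧸ I)) (I K : Ideal A) : ¬ DenselySplit I K := by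
  have key : ∀ I : Ideal A, DenselySplit I ⊤ → ∃ P, I ≤ P ∧ P.IsPrime ∧ DenselySplit P ⊤ := by
    intro I hI
    obtain ⟨J, hIJ, hJ, hb⟩ := hI.exists_infPrime ha (hfd I)
    refine ⟨J.radical, hIJ.trans J.le_radical, hJ.isPrime_radical ha, ?_⟩
    by_contra hPT
    exact hJ.not_denselySplit_top ha hfd (hid J) hPT (hb.mono le_rfl le_top)
  intro h
  obtain ⟨P, -, hP, hPT⟩ := key I (h.mono le_rfl le_top)
  obtain ⟨M, hM⟩ := exists_maximal_denselySplit_prime ha hid hP hPT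
  obtain ⟨K, h1, h2⟩ := hM.prop.2.exists_between
  obtain ⟨Q, hKQ, hQ⟩ := key K h2
  exact (h1.lt.trans_le hKQ).not_ge (hM.le_of_ge hQ (h1.lt.le.trans hKQ))

theorem not_denselySplit_quotient (h : ∀ X Y : Ideal A, ¬ DenselySplit X Y)
    (I : Ideal A) (X Y : Ideal (A ⧸ I)) : ¬ DenselySplit X Y := by
  intro hb
  have hinj := Ideal.comap_injective_of_surjective _ (Ideal.Quotient.mk_surjective (I := I))
  exact h _ _ (hb.map (φ := Ideal.comap (Ideal.Quotient.mk I))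
    (fun U V hUV => Ideal.comap_mono hUV) fun U V _ _ hUV he => hUV.ne (hinj he))

end Arithmetical

section Idempotent

variable {R : Type} [CommRing R]

/-- If every element of a proper essential ideal `B` is fixed by an element of `B`, then `R`
contains an infinite direct sum of nonzero ideals. -/
theorem not_finDimL_of_forall_exists_mul_eq {B : Ideal R} (hB : B ≠ ⊤)
    (hess : ∀ C : Ideal R, C ≠ ⊥ → B ⊓ C ≠ ⊥) (hu : ∀ b ∈ B, ∃ w ∈ B, w * b = b) :
    ¬ FinDimL (Ideal R) := by
  have step : ∀ e ∈ B, ∃ w ∈ B, w * e = e ∧ w ≠ e := by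
    intro e he
    by_cases hidem : e * e = e
    · have hne : Ideal.span {1 - e} ≠ ⊥ := by
        rw [Ne, Ideal.span_singleton_eq_bot, sub_eq_zero]
        rintro rfl
        exact hB ((Ideal.eq_top_iff_one B).2 he)
      obtain ⟨b, hb, hb0⟩ := (Submodule.ne_bot_iff _).1 (hess _ hne)
      obtain ⟨c, hc⟩ := Ideal.mem_span_singleton'.1 hb.2
      obtain ⟨w, hw, hwe⟩ := hu (e + b) (B.add_mem he hb.1)
      have heb : e * b = 0 := by
        rw [← hc]
        linear_combination -c * hidem
      have hwb : w * e + w * b = e + b := by rw [← mul_add, hwe]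
      have h1 : w * e = e := by
        linear_combination e * hwb + (1 - w) * heb + (1 - w) * hidem
      refine ⟨w, hw, h1, fun h => hb0 ?_⟩
      have h2 : w * b = b := by linear_combination hwb - h1
      rw [← h2, h, heb]
    · obtain ⟨w, hw, hwe⟩ := hu e he
      exact ⟨w, hw, hwe, fun h => hidem (h ▸ hwe)⟩
  choose! g hgB hge hgne using step
  let e : ℕ → R := fun n => Nat.rec 0 (fun _ x => g x) n
  have heB : ∀ n, e n ∈ B := by
    intro n
    induction n with
    | zero => exact B.zero_mem
    | succ n ih => exact hgB _ ih
  have hsucc : ∀ n, e (n + 1) * e n = e n := fun n => hge _ (heB n)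
  have hlt : ∀ m n, m < n → e n * e m = e m := by
    intro m n hmn
    induction n, hmn using Nat.le_induction with
    | base => exact hsucc m
    | succ n _ ih =>
      calc e (n + 1) * e m = (e (n + 1) * e n) * e m := by rw [mul_assoc, ih]
        _ = e m := by rw [hsucc, ih]
  intro hfd
  refine hfd ⟨fun n => Ideal.span {e (3 * n + 2) - e (3 * n + 1)}, fun n h0 => ?_, fun n => ?_⟩
  · rw [Ideal.span_singleton_eq_bot, sub_eq_zero] at h0
    exact hgne _ (heB (3 * n + 1)) h0
  · rw [eq_bot_iff]
    let u := e (3 * n + 3) - e (3 * n)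
    have hle : (⨆ m, ⨆ _ : m ≠ n, Ideal.span {e (3 * m + 2) - e (3 * m + 1)}) ≤
        LinearMap.ker (LinearMap.mulLeft R u) := by
      refine iSup₂_le fun m hm => ?_
      rw [Ideal.span_singleton_le_iff_mem, LinearMap.mem_ker, LinearMap.mulLeft_apply]
      rcases lt_or_gt_of_ne hm with h | h
      · linear_combination hlt (3 * m + 2) (3 * n + 3) (by omega) -
          hlt (3 * m + 2) (3 * n) (by omega) - hlt (3 * m + 1) (3 * n + 3) (by omega) +
          hlt (3 * m + 1) (3 * n) (by omega)
      · linear_combination hlt (3 * n + 3) (3 * m + 2) (by omega) -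
          hlt (3 * n) (3 * m + 2) (by omega) - hlt (3 * n + 3) (3 * m + 1) (by omega) +
          hlt (3 * n) (3 * m + 1) (by omega)
    rintro x ⟨h1, h2⟩
    obtain ⟨c, rfl⟩ := Ideal.mem_span_singleton'.1 h1
    have h3 : u * (c * (e (3 * n + 2) - e (3 * n + 1))) = 0 := hle h2
    show c * (e (3 * n + 2) - e (3 * n + 1)) = 0
    rw [← h3]
    linear_combination (-c) * (hlt (3 * n + 2) (3 * n + 3) (by omega) -
      hlt (3 * n + 1) (3 * n + 3) (by omega) - hlt (3 * n) (3 * n + 2) (by omega) +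
      hlt (3 * n) (3 * n + 1) (by omega))

/-- The elements some multiple of which, by an element outside the prime `M`, lies in `(x)`. -/
def localSpan (M : Ideal R) [M.IsPrime] (x : R) : Ideal R where
  carrier := {a | ∃ s ∉ M, ∃ c, s * a = c * x}
  zero_mem' := ⟨1, fun h => Ideal.IsPrime.ne_top ‹_› (M.eq_top_of_isUnit_mem h isUnit_one), 0,
    by simp⟩
  add_mem' := by
    rintro a b ⟨s, hs, c, hc⟩ ⟨t, ht, d, hd⟩
    exact ⟨s * t, fun h => (Ideal.IsPrime.mem_or_mem ‹_› h).elim hs ht, t * c + s * d,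
      by linear_combination t * hc + s * hd⟩
  smul_mem' := by
    rintro r a ⟨s, hs, c, hc⟩
    exact ⟨s, hs, r * c, by rw [smul_eq_mul]; linear_combination r * hc⟩

theorem mem_localSpan {M : Ideal R} [M.IsPrime] {x a : R} :
    a ∈ localSpan M x ↔ ∃ s ∉ M, ∃ c, s * a = c * x := Iff.rfl

theorem localSpan_le {M : Ideal R} [hM : M.IsPrime] {x y s c : R} (hs : s ∉ M)
    (h : s * x = c * y) : localSpan M x ≤ localSpan M y := by
  rintro a ⟨t, ht, d, hd⟩
  exact ⟨s * t, fun h => (hM.mem_or_mem h).elim hs ht, d * c,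
    by linear_combination s * hd + d * h⟩

theorem exists_denselySplit_of_idempotent
    (har : ∀ a b : R, ∃ e f c d : R, e + f = 1 ∧ e * a = c * b ∧ f * b = d * a)
    {B M : Ideal R} (hBB : B * B = B) (hM : M.IsPrime) (hBM : B ≤ M) {b : R} (hb : b ∈ B)
    (hbM : ∀ t, t * b = 0 → t ∈ M) : ∃ X Y : Ideal R, DenselySplit X Y := by
  have h1M : (1 : R) ∉ M := fun h => hM.ne_top (M.eq_top_of_isUnit_mem h isUnit_one)
  have hmul : ∀ {s t}, s ∉ M → t ∉ M → s * t ∉ M := fun hs ht h =>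
    (hM.mem_or_mem h).elim hs ht
  have hfac : ∀ p ∈ B * B, ∃ s ∉ M, ∃ q₁ ∈ B, ∃ q₂ ∈ B, ∃ c, s * p = c * (q₁ * q₂) := by
    intro p hp
    induction hp using Submodule.mul_induction_on' with
    | mem_mul_mem u hu v hv => exact ⟨1, h1M, u, hu, v, hv, 1, rfl⟩
    | add u _ v _ ihu ihv =>
      obtain ⟨s, hs, q₁, h₁, q₂, h₂, c, hc⟩ := ihu
      obtain ⟨t, ht, r₁, k₁, r₂, k₂, d, hd⟩ := ihv
      obtain ⟨e, f, i, j, hef, he, hf⟩ := har (q₁ * q₂) (r₁ * r₂)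
      by_cases heM : e ∈ M
      · have hfM : f ∉ M := fun h => h1M (hef ▸ M.add_mem heM h)
        exact ⟨f * (s * t), hmul hfM (hmul hs ht), q₁, h₁, q₂, h₂, f * t * c + s * d * j,
          by linear_combination f * t * hc + f * s * hd + s * d * hf⟩
      · exact ⟨e * (s * t), hmul heM (hmul hs ht), r₁, k₁, r₂, k₂, e * s * d + t * c * i,
          by linear_combination e * t * hc + e * s * hd + t * c * he⟩
  refine ⟨localSpan M b, localSpan M 1, fun X Y => ∃ x y, X = localSpan M x ∧
    Y = localSpan M y ∧ (∀ t, t * x = 0 → t ∈ M) ∧ ∃ p ∈ B, x = y * p, ?_, ?_,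
    b, 1, rfl, rfl, hbM, b, hb, (one_mul b).symm⟩
  · rintro _ _ ⟨x, y, rfl, rfl, hx, p, hp, rfl⟩
    refine lt_of_le_not_ge (localSpan_le h1M (c := p) (by ring)) fun hle => ?_
    obtain ⟨s, hs, c, hc⟩ := mem_localSpan.1 (hle ⟨1, h1M, 1, rfl⟩)
    have h0 : s - c * p ∈ M := hx _ (by linear_combination p * hc)
    have : s = (s - c * p) + c * p := by ring
    exact hs (this ▸ M.add_mem h0 (M.mul_mem_left _ (hBM hp)))
  · rintro _ _ ⟨x, y, rfl, rfl, hx, p, hp, rfl⟩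
    obtain ⟨s, hs, q₁, h₁, q₂, h₂, c, hc⟩ := hfac p (hBB.symm ▸ hp)
    have hsx : ∀ t, t * (s * (y * p)) = 0 → t ∈ M := fun t ht =>
      (hM.mem_or_mem (hx (t * s) (by rw [mul_assoc, ht]))).resolve_right hs
    refine ⟨localSpan M (y * q₁), ⟨s * (y * p), y * q₁, ?_, rfl, hsx, c * q₂,
      B.mul_mem_left _ h₂, by linear_combination y * hc⟩, y * q₁, y, rfl, rfl, ?_, q₁, h₁, rfl⟩
    · exact le_antisymm (localSpan_le hs (c := 1) (by ring)) (localSpan_le h1M (c := s) (by ring))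
    · exact fun t ht => hsx t (by linear_combination t * y * hc + c * q₂ * ht)

theorem noIdemEss_of_forall_not_denselySplit
    (har : ∀ a b : R, ∃ e f c d : R, e + f = 1 ∧ e * a = c * b ∧ f * b = d * a)
    (h : ∀ X Y : Ideal R, ¬ DenselySplit X Y) : NoIdemEss R := by
  intro B hB hess hBB
  refine not_finDimL_of_forall_exists_mul_eq hB hess (fun b hb => ?_)
    (finDimL_of_forall_not_denselySplit h)
  let N := LinearMap.ker (LinearMap.toSpanSingleton R R b)
  by_cases htop : N ⊔ B = ⊤
  · obtain ⟨u, hu, w, hw, huw⟩ := Submodule.mem_sup.1 ((Ideal.eq_top_iff_one _).1 htop)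
    have hu0 : u * b = 0 := hu
    exact ⟨w, hw, by linear_combination b * huw - hu0⟩
  · obtain ⟨M, hM, hle⟩ := Ideal.exists_le_maximal _ htop
    obtain ⟨X, Y, hXY⟩ := exists_denselySplit_of_idempotent har hBB hM.isPrime
      (le_sup_right.trans hle) hb fun t ht => hle (Ideal.mem_sup_left (show t ∈ N from ht))
    exact (h X Y hXY).elim

end Idempotent

theorem stmt14 (A : Type) [CommRing A] (ha : Arithmetical A) :
    HasKdimO (Ideal A) ↔
      ∀ I : Ideal A, FinDimL (Ideal (A ⧸ I)) ∧ NoIdemEss (A ⧸ I) := by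
  rw [hasKdimO_iff_forall_not_denselySplit]
  constructor
  · intro h I
    have hI := not_denselySplit_quotient h I
    refine ⟨finDimL_of_forall_not_denselySplit hI,
      noIdemEss_of_forall_not_denselySplit (fun a b => ?_) hI⟩
    obtain ⟨a, rfl⟩ := Ideal.Quotient.mk_surjective a
    obtain ⟨b, rfl⟩ := Ideal.Quotient.mk_surjective b
    obtain ⟨e, f, c, d, h1, h2, h3⟩ := ha.exists_mul_eq a b
    refine ⟨Ideal.Quotient.mk I e, Ideal.Quotient.mk I f, Ideal.Quotient.mk I c,
      Ideal.Quotient.mk I d, ?_, ?_, ?_⟩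
    · rw [← map_add, h1, map_one]
    · rw [← map_mul, h2, map_mul]
    · rw [← map_mul, h3, map_mul]
  · intro h
    exact not_denselySplit_of_finDimL_of_noIdemEss ha (fun I => (h I).1) fun I => (h I).2
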